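/- arXiv:1906.09581 — 4 statements merged into one kernel-verified Lean document; each statement's English description precedes it below -/
import Mathlib

section
/- For every τ > 0 and all real numbers s and t, the Huber loss satisfies ℓ_τ(s + t) ≤ ℓ_τ(s) + ℓ_τ(t) + τ². -/
/-- The Huber loss with robustification parameter `τ`. -/
noncomputable def huber (τ a : ℝ) : ℝ := if |a| ≤ τ then a ^ 2 / 2 else τ * |a| - τ ^ 2 / 2

theorem mul_abs_sub_le_huber (τ a : ℝ) : τ * |a| - τ ^ 2 / 2 ≤ huber τ a := by
  unfold huber
  split_ifs
  · nlinarith [sq_nonneg (|a| - τ), sq_abs a]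
  · exact le_rfl

theorem huber_le_mul_abs (τ a : ℝ) : huber τ a ≤ τ * |a| := by
  unfold huber
  split_ifs with h
  · nlinarith [mul_le_mul_of_nonneg_right h (abs_nonneg a), mul_self_nonneg a, sq_abs a]
  · nlinarith [sq_nonneg τ]

theorem huber_add_le (τ : ℝ) (hτ : 0 < τ) (s t : ℝ) :
    huber τ (s + t) ≤ huber τ s + huber τ t + τ ^ 2 := by
  have h := mul_le_mul_of_nonneg_left (abs_add_le s t) hτ.le
  linarith [huber_le_mul_abs τ (s + t), mul_abs_sub_le_huber τ s, mul_abs_sub_le_huber τ t]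
end

section
/- Let τ > 0, ρ > 0, and let x, c ∈ ℝ. The function f(w) = ℓ_τ(x − w) + (ρ/2)(w − c)² has a unique global minimizer over w ∈ ℝ, given by w* = (x + ρc)/(1 + ρ) if |ρ(x − c)/(1 + ρ)| ≤ τ, and w* = x − S(x − c, τ/ρ) otherwise, where S(a, b) = sign(a)·max(|a| − b, 0) is the soft-thresholding operator. -/
/-- The soft-thresholding operator `S(a, b) = sign(a) · max(|a| − b, 0)`. -/
noncomputable def softThresh (a b : ℝ) : ℝ := Real.sign a * max (|a| - b) 0

/-- The Fenchel–Young inequality for the Huber loss. -/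
theorem mul_sub_sq_le_huber {τ g : ℝ} (hg : |g| ≤ τ) (b : ℝ) :
    g * b - g ^ 2 / 2 ≤ huber τ b := by
  obtain ⟨h₁, h₂⟩ := abs_le.mp hg
  unfold huber
  split_ifs with h
  · nlinarith [sq_nonneg (g - b)]
  · push Not at h
    rcases abs_cases b with ⟨hb, _⟩ | ⟨hb, _⟩ <;> rw [hb] at h ⊢
    · nlinarith [mul_nonneg (sub_nonneg.mpr h₂) (sub_nonneg.mpr h.le), sq_nonneg (τ - g)]
    · nlinarith [mul_nonneg (neg_le_iff_add_nonneg.mp h₁) (sub_nonneg.mpr h.le),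
        sq_nonneg (τ + g)]

/-- A point satisfying the first-order optimality condition minimizes the proximal objective with
quadratic growth. -/
theorem huber_prox_quadratic_growth {τ ρ x c v : ℝ} (hg : |ρ * (v - c)| ≤ τ)
    (hv : huber τ (x - v) = ρ * (v - c) * (x - v) - (ρ * (v - c)) ^ 2 / 2) (w : ℝ) :
    huber τ (x - v) + ρ / 2 * (v - c) ^ 2 + ρ / 2 * (w - v) ^ 2 ≤
      huber τ (x - w) + ρ / 2 * (w - c) ^ 2 := by
  rw [hv]
  linear_combination mul_sub_sq_le_huber hg (x - w)

theorem huber_prox_update (τ ρ x c : ℝ) (hτ : 0 < τ) (hρ : 0 < ρ) :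
    let f : ℝ → ℝ := fun w => huber τ (x - w) + ρ / 2 * (w - c) ^ 2
    let wstar : ℝ :=
      if |ρ * (x - c) / (1 + ρ)| ≤ τ then (x + ρ * c) / (1 + ρ)
      else x - softThresh (x - c) (τ / ρ)
    (∀ w, f wstar ≤ f w) ∧ ∀ w, (∀ w', f w ≤ f w') → w = wstar := by
  intro f wstar
  have optimality : |ρ * (wstar - c)| ≤ τ ∧ huber τ (x - wstar) =
      ρ * (wstar - c) * (x - wstar) - (ρ * (wstar - c)) ^ 2 / 2 := by
    have hρ' : 0 < 1 + ρ := by positivity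
    by_cases h : |ρ * (x - c) / (1 + ρ)| ≤ τ
    · have hw : wstar = (x + ρ * c) / (1 + ρ) := if_pos h
      have hg : ρ * (wstar - c) = ρ * (x - c) / (1 + ρ) := by rw [hw]; field_simp; ring
      have ha : x - wstar = ρ * (x - c) / (1 + ρ) := by rw [hw]; field_simp; ring
      rw [hg, ha, huber, if_pos h]
      exact ⟨h, by ring⟩
    · have hw : wstar = x - softThresh (x - c) (τ / ρ) := if_neg h
      have hd : τ + τ / ρ < |x - c| := by
        rw [not_le, abs_div, abs_mul, abs_of_pos hρ, abs_of_pos hρ', lt_div_iff₀ hρ'] at h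
        have : τ + τ / ρ = τ * (1 + ρ) / ρ := by field_simp; ring
        rwa [this, div_lt_iff₀ hρ, mul_comm |x - c|]
      have hq : 0 < τ / ρ := by positivity
      have hm : max (|x - c| - τ / ρ) 0 = |x - c| - τ / ρ := max_eq_left (by linarith)
      have hρq : ρ * (τ / ρ) = τ := by field_simp
      rw [softThresh, hm] at hw
      rcases abs_cases (x - c) with ⟨hb, _⟩ | ⟨hb, hneg⟩
      · rw [hb] at hd hw
        rw [Real.sign_of_pos (by linarith)] at hw
        have hg : ρ * (wstar - c) = τ := by rw [hw]; linear_combination hρq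
        have ha : τ < x - wstar := by linarith
        rw [hg, huber, abs_of_pos hτ, abs_of_pos (hτ.trans ha), if_neg ha.not_ge]
        exact ⟨le_rfl, rfl⟩
      · rw [hb] at hd hw
        rw [Real.sign_of_neg hneg] at hw
        have hg : ρ * (wstar - c) = -τ := by rw [hw]; linear_combination -hρq
        have ha : τ < -(x - wstar) := by linarith
        rw [hg, huber, abs_neg, abs_of_pos hτ, abs_of_neg (by linarith), if_neg ha.not_ge]
        exact ⟨le_rfl, by ring⟩
  have growth : ∀ w, f wstar + ρ / 2 * (w - wstar) ^ 2 ≤ f w :=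
    huber_prox_quadratic_growth optimality.1 optimality.2
  refine ⟨fun w => le_trans (le_add_of_nonneg_right (by positivity)) (growth w), fun w hw => ?_⟩
  have hle : ρ / 2 * (w - wstar) ^ 2 ≤ 0 := by linarith [growth w, hw wstar]
  have hsq : (w - wstar) ^ 2 ≤ 0 := nonpos_of_mul_nonpos_right hle (by positivity)
  exact sub_eq_zero.mp (pow_eq_zero_iff two_ne_zero |>.mp (le_antisymm hsq (sq_nonneg _)))
end

section
/- (Theorem 1, upper bound on the breakdown point.) Let τ > 0, λ > 0, n ≥ 1, p ≥ 1, and let X ∈ ℝ^{n×p}. Set m = ⌊(n+1)/2⌋. Then the robust convex clustering estimator breaks down under m arbitrary outliers: for every R > 0 there exist a contaminated matrix X̃ ∈ ℝ^{n×p} differing from X in at most m rows and a global minimizer U of the objective L_τ(·, X̃) such that ‖U‖_F > R. -/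
/-- The robust convex clustering objective with unit weights. -/
noncomputable def rccObj (n p : ℕ) (τ lam : ℝ) (X U : Matrix (Fin n) (Fin p) ℝ) : ℝ :=
  (∑ i, ∑ j, huber τ (X i j - U i j)) +
    lam * ∑ q ∈ Finset.univ.filter (fun q : Fin n × Fin n => q.1 < q.2),
      Real.sqrt (∑ j, (U q.1 j - U q.2 j) ^ 2)

lemma huber_nonneg {τ : ℝ} (hτ : 0 < τ) (a : ℝ) : 0 ≤ huber τ a := by
  unfold huber
  split_ifs with h
  · positivity
  · nlinarith

lemma huber_sub_le {τ : ℝ} (hτ : 0 < τ) (a b : ℝ) : huber τ a - huber τ b ≤ τ * |a - b| := by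
  have h : τ * (|a| - |b|) ≤ τ * |a - b| :=
    mul_le_mul_of_nonneg_left (abs_sub_abs_le_abs_sub a b) hτ.le
  have h' : τ * (|b| - |a|) ≤ τ * |a - b| := by
    rw [abs_sub_comm a b]
    exact mul_le_mul_of_nonneg_left (abs_sub_abs_le_abs_sub b a) hτ.le
  have ha := abs_nonneg a
  have hb := abs_nonneg b
  unfold huber
  rw [← sq_abs a, ← sq_abs b]
  split_ifs with h1 h2 h2
  · rcases le_total |a| |b| with h3 | h3
    · nlinarith [abs_nonneg (a - b), mul_nonneg hτ.le (abs_nonneg (a - b))]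
    · nlinarith [mul_nonneg (sub_nonneg.2 h3) (by linarith : 0 ≤ 2 * τ - |a| - |b|)]
  · nlinarith [mul_nonneg (sub_nonneg.2 h1) (by linarith : 0 ≤ 3 * τ - |a|)]
  · nlinarith [sq_nonneg (|b| - τ)]
  · linarith

lemma continuous_huber {τ : ℝ} (hτ : 0 < τ) : Continuous (huber τ) :=
  (LipschitzWith.of_le_add_mul' τ fun a b => by
    rw [Real.dist_eq]
    linarith [huber_sub_le hτ a b]).continuous

lemma huber_of_le {τ a : ℝ} (hτ : 0 < τ) (ha : τ ≤ a) : huber τ a = τ * a - τ ^ 2 / 2 := by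
  unfold huber
  rw [abs_of_nonneg (hτ.le.trans ha)]
  split_ifs with h
  · obtain rfl := le_antisymm h ha
    ring
  · rfl

lemma continuous_rccObj (n p : ℕ) {τ : ℝ} (lam : ℝ) (hτ : 0 < τ)
    (X : Matrix (Fin n) (Fin p) ℝ) : Continuous (rccObj n p τ lam X) := by
  have hU : ∀ i j, Continuous fun U : Matrix (Fin n) (Fin p) ℝ => U i j := fun i j =>
    continuous_id.matrix_elem i j
  unfold rccObj
  refine Continuous.add ?_ (continuous_const.mul ?_)
  · exact continuous_finsetSum _ fun i _ => continuous_finsetSum _ fun j _ =>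
      (continuous_huber hτ).comp (continuous_const.sub (hU i j))
  · exact continuous_finsetSum _ fun q _ => Real.continuous_sqrt.comp
      (continuous_finsetSum _ fun j _ => ((hU q.1 j).sub (hU q.2 j)).pow 2)

lemma huber_le_rccObj {n p : ℕ} {τ lam : ℝ} (hτ : 0 < τ) (hlam : 0 ≤ lam)
    (X U : Matrix (Fin n) (Fin p) ℝ) (i : Fin n) (j : Fin p) :
    huber τ (X i j - U i j) ≤ rccObj n p τ lam X U := by
  have h1 : huber τ (X i j - U i j) ≤ ∑ j, huber τ (X i j - U i j) :=
    Finset.single_le_sum (f := fun j => huber τ (X i j - U i j))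
      (fun j _ => huber_nonneg hτ _) (Finset.mem_univ j)
  have h2 : ∑ j, huber τ (X i j - U i j) ≤ ∑ i, ∑ j, huber τ (X i j - U i j) :=
    Finset.single_le_sum (f := fun i => ∑ j, huber τ (X i j - U i j))
      (fun i _ => Finset.sum_nonneg fun j _ => huber_nonneg hτ _) (Finset.mem_univ i)
  refine (h1.trans h2).trans (le_add_of_nonneg_right (mul_nonneg hlam ?_))
  exact Finset.sum_nonneg fun q _ => Real.sqrt_nonneg _

/-- The objective is continuous and coercive, so it attains its minimum. -/
lemma exists_rccObj_minimizer (n p : ℕ) {τ lam : ℝ} (hτ : 0 < τ) (hlam : 0 ≤ lam)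
    (X : Matrix (Fin n) (Fin p) ℝ) :
    ∃ U, ∀ V, rccObj n p τ lam X U ≤ rccObj n p τ lam X V := by
  set B := τ + |rccObj n p τ lam X X| / τ with hB
  have hτB : τ ≤ B := le_add_of_nonneg_right (by positivity)
  let K : Set (Matrix (Fin n) (Fin p) ℝ) :=
    Set.univ.pi fun i => Set.univ.pi fun j => Set.Icc (X i j - B) (X i j + B)
  have hK : IsCompact K := isCompact_univ_pi fun i => isCompact_univ_pi fun j => isCompact_Icc
  have hXK : X ∈ K := fun i _ j _ => ⟨by linarith, by linarith⟩
  obtain ⟨U, -, hU⟩ := hK.exists_isMinOn ⟨X, hXK⟩ (continuous_rccObj n p lam hτ X).continuousOn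
  refine ⟨U, fun V => ?_⟩
  by_cases hV : V ∈ K
  · exact hU hV
  refine (hU hXK).trans ?_
  obtain ⟨i, j, hij⟩ : ∃ i j, B < |X i j - V i j| := by
    by_contra! h
    refine hV fun i _ j _ => ?_
    have := abs_le.1 (h i j)
    exact ⟨by linarith, by linarith⟩
  refine le_trans ?_ (huber_le_rccObj hτ hlam X V i j)
  unfold huber
  rw [if_neg (not_le.2 (hτB.trans_lt hij))]
  have h1 : τ * B = τ ^ 2 + |rccObj n p τ lam X X| := by
    rw [hB]
    field_simp
  nlinarith [le_abs_self (rccObj n p τ lam X X), mul_lt_mul_of_pos_left hij hτ]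

lemma abs_le_sqrt_sum_sq {n p : ℕ} (U : Matrix (Fin n) (Fin p) ℝ) (i : Fin n) (j : Fin p) :
    |U i j| ≤ Real.sqrt (∑ i, ∑ j, (U i j) ^ 2) := by
  refine Real.abs_le_sqrt ?_
  exact (Finset.single_le_sum (f := fun j => (U i j) ^ 2) (fun j _ => sq_nonneg _)
    (Finset.mem_univ j)).trans
    (Finset.single_le_sum (f := fun i => ∑ j, (U i j) ^ 2)
      (fun i _ => Finset.sum_nonneg fun j _ => sq_nonneg _) (Finset.mem_univ i))

/-- Translating every row by the same vector leaves the fusion penalty unchanged. If at least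
half of the rows of `X` lie far enough in the direction of the translation, the Huber part does
not increase. -/
lemma rccObj_translate_le {n p : ℕ} {τ : ℝ} (lam : ℝ) (hτ : 0 < τ) {t : ℝ} (ht : 0 ≤ t)
    (X U : Matrix (Fin n) (Fin p) ℝ) (S : Finset (Fin n)) (hS : n ≤ 2 * S.card)
    (hX : ∀ i ∈ S, ∀ j, τ + t ≤ X i j - U i j) :
    rccObj n p τ lam X (fun i j => U i j + t) ≤ rccObj n p τ lam X U := by
  unfold rccObj
  simp only [add_sub_add_right_eq_sub]
  gcongr ?_ + _
  have hrow : ∀ i, ∑ j, huber τ (X i j - (U i j + t)) ≤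
      ∑ j, huber τ (X i j - U i j) + (p * (τ * t) - if i ∈ S then 2 * (p * (τ * t)) else 0) := by
    intro i
    split_ifs with hi
    · have h : ∀ j, huber τ (X i j - (U i j + t)) = huber τ (X i j - U i j) - τ * t := fun j => by
        have := hX i hi j
        rw [huber_of_le hτ (by linarith), huber_of_le hτ (by linarith)]
        ring
      simp only [h, Finset.sum_sub_distrib, Finset.sum_const, Finset.card_univ, Fintype.card_fin,
        nsmul_eq_mul]
      linarith
    · have h : ∀ j, huber τ (X i j - (U i j + t)) ≤ huber τ (X i j - U i j) + τ * t := fun j => by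
        have := huber_sub_le hτ (X i j - (U i j + t)) (X i j - U i j)
        rw [show X i j - (U i j + t) - (X i j - U i j) = -t by ring, abs_neg,
          abs_of_nonneg ht] at this
        linarith
      refine (Finset.sum_le_sum fun j _ => h j).trans (le_of_eq ?_)
      simp [Finset.sum_add_distrib]
  refine (Finset.sum_le_sum fun i _ => hrow i).trans ?_
  rw [Finset.sum_add_distrib, Finset.sum_sub_distrib, Finset.sum_ite_mem, Finset.univ_inter]
  simp only [Finset.sum_const, Finset.card_univ, Fintype.card_fin, nsmul_eq_mul]
  have hS' : (n : ℝ) ≤ 2 * S.card := by exact_mod_cast hS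
  have hpt : 0 ≤ p * (τ * t) := by positivity
  nlinarith [mul_le_mul_of_nonneg_right hS' hpt]

/-- Theorem 1 (upper bound on the breakdown point): with `m = ⌊(n+1)/2⌋` arbitrary
outliers, the robust convex clustering estimator breaks down. -/
theorem rcc_breakdown_upper_bound (n p : ℕ) (hn : 1 ≤ n) (hp : 1 ≤ p) (τ lam : ℝ)
    (hτ : 0 < τ) (hlam : 0 < lam) (X : Matrix (Fin n) (Fin p) ℝ) :
    ∀ R > (0 : ℝ), ∃ Xt : Matrix (Fin n) (Fin p) ℝ,
      {i : Fin n | Xt i ≠ X i}.ncard ≤ (n + 1) / 2 ∧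
      ∃ U : Matrix (Fin n) (Fin p) ℝ,
        (∀ V, rccObj n p τ lam Xt U ≤ rccObj n p τ lam Xt V) ∧
        R < Real.sqrt (∑ i, ∑ j, (U i j) ^ 2) := by
  intro R hR
  obtain ⟨S, -, hS⟩ := Finset.exists_subset_card_eq
    (s := (Finset.univ : Finset (Fin n))) (n := (n + 1) / 2) (by simp; omega)
  let Xt : Matrix (Fin n) (Fin p) ℝ := fun i => if i ∈ S then fun _ => τ + 3 * R + 1 else X i
  refine ⟨Xt, ?_, ?_⟩
  · rw [← hS, ← Set.ncard_coe_finset]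
    refine Set.ncard_le_ncard (fun i hi => ?_) S.finite_toSet
    by_contra h
    exact hi (if_neg h)
  obtain ⟨U, hU⟩ := exists_rccObj_minimizer n p hτ hlam.le Xt
  by_cases hUR : R < Real.sqrt (∑ i, ∑ j, (U i j) ^ 2)
  · exact ⟨U, hU, hUR⟩
  have hbd : ∀ i j, |U i j| ≤ R := fun i j => (abs_le_sqrt_sum_sq U i j).trans (not_lt.1 hUR)
  refine ⟨fun i j => U i j + (2 * R + 1), fun V => le_trans ?_ (hU V), ?_⟩
  · refine rccObj_translate_le lam hτ (by linarith) Xt U S (by omega) fun i hi j => ?_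
    have hXt : Xt i j = τ + 3 * R + 1 := by simp [Xt, hi]
    linarith [(abs_le.1 (hbd i j)).2]
  · refine lt_of_lt_of_le ?_ (abs_le_sqrt_sum_sq _ ⟨0, hn⟩ ⟨0, hp⟩)
    refine lt_of_lt_of_le ?_ (le_abs_self _)
    linarith [(abs_le.1 (hbd ⟨0, hn⟩ ⟨0, hp⟩)).1]
end

section
/- For every τ > 0 and all real s, t with |s + t| > τ, |s| ≤ τ, and |t| ≤ τ (so that s and t have the same sign), the Huber loss satisfies ℓ_τ(s + t) ≤ ℓ_τ(s) + ℓ_τ(t) + τ²/2. -/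
theorem huber_add_le_case4 (τ s t : ℝ) (hτ : 0 < τ) (h1 : τ < |s + t|)
    (h2 : |s| ≤ τ) (h3 : |t| ≤ τ) :
    huber τ (s + t) ≤ huber τ s + huber τ t + τ ^ 2 / 2 := by
  unfold huber
  rw [if_neg (not_le.mpr h1), if_pos h2, if_pos h3]
  have h := mul_le_mul_of_nonneg_left (abs_add_le s t) hτ.le
  nlinarith [sq_nonneg (|s| - τ), sq_nonneg (|t| - τ), sq_abs s, sq_abs t]
end
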